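/- arXiv:1603.00671 — 6 statements merged into one kernel-verified Lean document; each statement's English description precedes it below -/
import Mathlib

section
/- If a permutation σ of Fin n and a price vector p : Fin n → ℝ satisfy ε-complementary slackness for some ε ≥ 0, then the primal value ∑_i c i (σ i) is at least the dual value ∑_i (max_j (c i j - p j)) + ∑_j p j minus n·ε. -/
/-- If a permutation `σ` and a price vector `p` satisfy ε-complementary slackness for some
`ε ≥ 0`, then the primal value is at least the dual value minus `n·ε`. -/
theorem epsCS_primal_ge_dual_sub (n : ℕ) (c : Fin n → Fin n → ℝ) (p : Fin n → ℝ)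
    (σ : Equiv.Perm (Fin n)) (ε : ℝ) (hε : 0 ≤ ε)
    (hcs : ∀ i, c i (σ i) - p (σ i) ≥ (⨆ j, (c i j - p j)) - ε) :
    ∑ i, c i (σ i) ≥ ((∑ i, ⨆ j, (c i j - p j)) + ∑ j, p j) - n * ε := by
  have h := Finset.sum_le_sum (fun i (_ : i ∈ Finset.univ) => hcs i)
  have hp : ∑ i, p (σ i) = ∑ j, p j := Equiv.sum_comp σ p
  simp only [Finset.sum_sub_distrib, Finset.sum_const, Finset.card_univ, Fintype.card_fin,
    nsmul_eq_mul] at h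
  linarith
end

section
/- (Near-optimality of ε-CS assignments, Theorem 2, first part.) If a permutation σ of Fin n and a price vector p : Fin n → ℝ satisfy ε-complementary slackness for some ε ≥ 0, then σ is within n·ε of optimal: for every permutation τ of Fin n, ∑_i c i (σ i) ≥ ∑_i c i (τ i) - n·ε. -/
/-- Near-optimality of ε-CS assignments: if `σ` and `p` satisfy ε-complementary slackness
for some `ε ≥ 0`, then `σ` is within `n·ε` of optimal. -/
theorem epsCS_near_optimal (n : ℕ) (c : Fin n → Fin n → ℝ) (p : Fin n → ℝ)
    (σ : Equiv.Perm (Fin n)) (ε : ℝ) (hε : 0 ≤ ε)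
    (hcs : ∀ i, c i (σ i) - p (σ i) ≥ (⨆ j, (c i j - p j)) - ε) :
    ∀ τ : Equiv.Perm (Fin n), ∑ i, c i (σ i) ≥ (∑ i, c i (τ i)) - n * ε := by
  intro τ
  have h : ∑ i, (c i (τ i) - p (τ i) - ε) ≤ ∑ i, (c i (σ i) - p (σ i)) := by
    apply Finset.sum_le_sum
    intro i _
    have h1 : c i (τ i) - p (τ i) ≤ ⨆ j, (c i j - p j) :=
      le_ciSup (f := fun j => c i j - p j) (Set.finite_range _).bddAbove (τ i)
    have h2 := hcs i
    linarith
  simp only [Finset.sum_sub_distrib, Equiv.sum_comp τ p, Equiv.sum_comp σ p,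
    Finset.sum_const, Finset.card_univ, Fintype.card_fin, nsmul_eq_mul] at h
  linarith
end

section
/- (Exact optimality for integer benefits, Theorem 2, second part.) Suppose n ≥ 1, the benefits are integer valued, i.e. c : Fin n → Fin n → ℤ, and 0 < ε < 1/n. If a permutation σ of Fin n and a price vector p : Fin n → ℝ satisfy ε-complementary slackness (with respect to the real-valued benefits given by c), then σ is an optimal assignment: for every permutation τ of Fin n, ∑_i c i (σ i) ≥ ∑_i c i (τ i). -/
/-- Exact optimality for integer benefits: if the benefits are integer valued,
`0 < ε < 1/n`, and `σ`, `p` satisfy ε-complementary slackness (with respect to the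
real-valued benefits), then `σ` is an optimal assignment. -/
theorem epsCS_integer_optimal (n : ℕ) (hn : 1 ≤ n) (c : Fin n → Fin n → ℤ)
    (ε : ℝ) (hε0 : 0 < ε) (hε1 : ε < 1 / n)
    (p : Fin n → ℝ) (σ : Equiv.Perm (Fin n))
    (hcs : ∀ i, (c i (σ i) : ℝ) - p (σ i) ≥ (⨆ j, ((c i j : ℝ) - p j)) - ε) :
    ∀ τ : Equiv.Perm (Fin n), ∑ i, c i (σ i) ≥ ∑ i, c i (τ i) := by
  intro τ
  have hn' : (0 : ℝ) < n := by exact_mod_cast hn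
  have h1 : ∀ i, (c i (τ i) : ℝ) - p (τ i) - ε ≤ (c i (σ i) : ℝ) - p (σ i) := by
    intro i
    have h := le_ciSup (f := fun j => (c i j : ℝ) - p j) (Set.finite_range _).bddAbove (τ i)
    have h2 := hcs i
    linarith
  have h2 := Finset.sum_le_sum (fun i (_ : i ∈ Finset.univ) => h1 i)
  simp only [Finset.sum_sub_distrib, Equiv.sum_comp, Finset.sum_const, Finset.card_univ,
    Fintype.card_fin, nsmul_eq_mul] at h2
  have h3 : (n : ℝ) * ε < 1 := by
    rw [lt_div_iff₀ hn'] at hε1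
    linarith
  have h4 : ((∑ i, c i (τ i) : ℤ) : ℝ) < ((∑ i, c i (σ i) + 1 : ℤ) : ℝ) := by
    push_cast
    linarith
  have h5 : ∑ i, c i (τ i) < ∑ i, c i (σ i) + 1 := by exact_mod_cast h4
  exact Int.lt_add_one_iff.mp h5
end

section
/- (Counting bound underlying the termination of the auction, Theorem 1.) Let ε > 0, B ≥ 0, and let p : Fin (T+1) → Fin J → ℝ be a finite sequence of price vectors such that p 0 = 0, every coordinate of every p t is at most B, and for each step t < T there is an index j_t with p (t+1) j_t ≥ p t j_t + ε while p (t+1) k = p t k for all k ≠ j_t. Then the number of steps satisfies T ≤ J · ⌈B / ε⌉. -/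
/-- Counting bound for the termination of the auction: if prices start at zero, stay
bounded by `B`, and each step raises exactly one of the `J` coordinates by at least
`ε > 0` while leaving the others unchanged, then the number of steps `T` is at most
`J · ⌈B / ε⌉`. -/
theorem auction_step_bound (J T : ℕ) (ε B : ℝ) (hε : 0 < ε) (hB : 0 ≤ B)
    (p : Fin (T + 1) → Fin J → ℝ)
    (h0 : p 0 = 0)
    (hbd : ∀ t j, p t j ≤ B)
    (hstep : ∀ t : Fin T, ∃ j, p t.succ j ≥ p t.castSucc j + ε ∧
      ∀ k ≠ j, p t.succ k = p t.castSucc k) :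
    (T : ℤ) ≤ J * ⌈B / ε⌉ := by
  have key : ∀ t : Fin (T + 1), (t : ℕ) * ε ≤ ∑ j, p t j := by
    intro t
    induction t using Fin.induction with
    | zero => simp [h0]
    | succ t ih =>
      obtain ⟨j, hj, hk⟩ := hstep t
      have h1 := Finset.add_sum_erase Finset.univ (p t.succ) (Finset.mem_univ j)
      have h2 := Finset.add_sum_erase Finset.univ (p t.castSucc) (Finset.mem_univ j)
      have h3 : ∑ k ∈ Finset.univ.erase j, p t.succ k
          = ∑ k ∈ Finset.univ.erase j, p t.castSucc k :=
        Finset.sum_congr rfl fun k hk' => hk k (Finset.ne_of_mem_erase hk')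
      simp only [Fin.val_castSucc, Fin.val_succ] at ih ⊢
      push_cast
      linarith
  have hT := key (Fin.last T)
  have hS : ∑ j, p (Fin.last T) j ≤ J * B := by
    calc ∑ j, p (Fin.last T) j ≤ ∑ _j : Fin J, B := Finset.sum_le_sum fun j _ => hbd _ j
      _ = J * B := by simp
  rw [Fin.val_last] at hT
  have h4 : (T : ℝ) ≤ J * (B / ε) := by
    rw [← mul_div_assoc, le_div_iff₀ hε]
    exact hT.trans hS
  have h5 : (J : ℝ) * (B / ε) ≤ J * (⌈B / ε⌉ : ℝ) :=
    mul_le_mul_of_nonneg_left (Int.le_ceil _) (Nat.cast_nonneg J)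
  exact_mod_cast h4.trans h5
end

section
/- (The bid formula raises the price and preserves ε-CS for the bidder.) Let n ≥ 2, ε > 0, c : Fin n → Fin n → ℝ, p : Fin n → ℝ, and fix an uplink user i. Let j* be an index attaining max_j (c i j - p j), let w = max over j ≠ j* of (c i j - p j), and define the updated prices p' by p' j* = c i j* - w + ε and p' j = p j for j ≠ j*. Then (a) p' j* ≥ p j* + ε, and (b) c i j* - p' j* ≥ (max_j (c i j - p' j)) - ε. -/
/-- The bid formula raises the price and preserves ε-CS for the bidder: if `j*` attains
`max_j (c i j - p j)`, `w` is the second-best utility, and the new price of `j*` is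
`c i j* - w + ε` (other prices unchanged), then the price of `j*` rises by at least `ε`
and the bidder satisfies ε-complementary slackness at `j*` with the new prices. -/
theorem bid_raises_price_and_preserves_epsCS (n : ℕ) (hn : 2 ≤ n) (ε : ℝ) (hε : 0 < ε)
    (c : Fin n → Fin n → ℝ) (p : Fin n → ℝ) (i : Fin n) (jstar : Fin n)
    (hjstar : c i jstar - p jstar = ⨆ j, (c i j - p j))
    (w : ℝ) (hw : w = ⨆ j : {j : Fin n // j ≠ jstar}, (c i (j : Fin n) - p (j : Fin n)))
    (p' : Fin n → ℝ)
    (hp'star : p' jstar = c i jstar - w + ε)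
    (hp' : ∀ j ≠ jstar, p' j = p j) :
    p' jstar ≥ p jstar + ε ∧ c i jstar - p' jstar ≥ (⨆ j, (c i j - p' j)) - ε := by
  have hnt : Nontrivial (Fin n) := Fin.nontrivial_iff_two_le.mpr hn
  obtain ⟨k, hk⟩ := exists_ne jstar
  haveI : Nonempty {j : Fin n // j ≠ jstar} := ⟨⟨k, hk⟩⟩
  haveI : Nonempty (Fin n) := ⟨jstar⟩
  have hmax : ∀ j, c i j - p j ≤ c i jstar - p jstar := fun j => by
    rw [hjstar]
    exact le_ciSup (f := fun j => c i j - p j) (Set.finite_range _).bddAbove j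
  have hle : w ≤ c i jstar - p jstar := by
    rw [hw]
    exact ciSup_le fun j => hmax j
  have hge : ∀ j, j ≠ jstar → c i j - p j ≤ w := fun j hj => by
    rw [hw]
    exact le_ciSup (f := fun j : {j : Fin n // j ≠ jstar} => c i (j : Fin n) - p (j : Fin n))
      (Set.finite_range _).bddAbove ⟨j, hj⟩
  have hsup : (⨆ j, (c i j - p' j)) ≤ w := by
    refine ciSup_le fun j => ?_
    by_cases hj : j = jstar
    · rw [hj, hp'star]
      linarith
    · rw [hp' j hj]
      exact hge j hj
  constructor <;> linarith
end

section
/- (At least one transmit power is at its maximum at the optimum of the pair power-allocation problem.) Let G_u, G_d, G_I, β, αu, αd, s, Pmax be real numbers with G_u > 0, G_d > 0, G_I ≥ 0, β ≥ 0, αu > 0, αd > 0, s > 0, Pmax > 0, and define f : ℝ × ℝ → ℝ by f (p, q) = αu · log (1 + G_u · p / (s + β · q)) + αd · log (1 + G_d · q / (s + G_I · p)). Then there exists (p*, q*) ∈ [0, Pmax] × [0, Pmax] with p* = Pmax or q* = Pmax such that f (p, q) ≤ f (p*, q*) for all (p, q) ∈ [0, Pmax] × [0, Pmax]. -/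
theorem sinr_scale {G b s p q t : ℝ} (hG : 0 < G) (hb : 0 ≤ b) (hs : 0 < s)
    (hp : 0 ≤ p) (hq : 0 ≤ q) (ht : 1 ≤ t) :
    G * p / (s + b * q) ≤ G * (t * p) / (s + b * (t * q)) := by
  have ht0 : 0 ≤ t := by linarith
  rw [div_le_div_iff₀ (by positivity) (by positivity)]
  have h : 0 ≤ (t - 1) * (G * p * s) := mul_nonneg (by linarith) (by positivity)
  nlinarith

theorem scale_exists {p q P : ℝ} (hp : 0 ≤ p) (hq : 0 ≤ q) (hpP : p ≤ P) (hqP : q ≤ P)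
    (h : 0 < p ∨ 0 < q) :
    ∃ t : ℝ, 1 ≤ t ∧ t * p ≤ P ∧ t * q ≤ P ∧ (t * p = P ∨ t * q = P) := by
  have key : ∀ a b : ℝ, 0 < a → 0 ≤ b → b ≤ a → a ≤ P →
      1 ≤ P / a ∧ P / a * a = P ∧ P / a * b ≤ P := by
    intro a b ha hb hba haP
    have h2 : P / a * a = P := div_mul_cancel₀ P ha.ne'
    refine ⟨(one_le_div ha).2 haP, h2, ?_⟩
    calc P / a * b ≤ P / a * a :=
          mul_le_mul_of_nonneg_left hba (div_nonneg (by linarith) ha.le)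
      _ = P := h2
  rcases le_total q p with hqp | hpq
  · have hp0 : 0 < p := by rcases h with h | h <;> linarith
    obtain ⟨h1, h2, h3⟩ := key p q hp0 hq hqp hpP
    exact ⟨P / p, h1, h2.le, h3, Or.inl h2⟩
  · have hq0 : 0 < q := by rcases h with h | h <;> linarith
    obtain ⟨h1, h2, h3⟩ := key q p hq0 hp hpq hqP
    exact ⟨P / q, h1, h3, h2.le, Or.inr h2⟩

/-- At least one transmit power is at its maximum at the optimum of the pair
power-allocation problem: the weighted sum spectral efficiency of a co-scheduled
uplink–downlink pair attains its maximum over the box `[0, Pmax]²` at a point where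
at least one of the two powers equals `Pmax`. -/
theorem pair_power_allocation_boundary_optimum
    (Gu Gd GI β αu αd s Pmax : ℝ)
    (hGu : 0 < Gu) (hGd : 0 < Gd) (hGI : 0 ≤ GI) (hβ : 0 ≤ β)
    (hαu : 0 < αu) (hαd : 0 < αd) (hs : 0 < s) (hP : 0 < Pmax) :
    ∃ pq : ℝ × ℝ, pq ∈ Set.Icc (0 : ℝ) Pmax ×ˢ Set.Icc (0 : ℝ) Pmax ∧
      (pq.1 = Pmax ∨ pq.2 = Pmax) ∧
      ∀ p q : ℝ, p ∈ Set.Icc (0 : ℝ) Pmax → q ∈ Set.Icc (0 : ℝ) Pmax →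
        αu * Real.log (1 + Gu * p / (s + β * q)) +
          αd * Real.log (1 + Gd * q / (s + GI * p)) ≤
        αu * Real.log (1 + Gu * pq.1 / (s + β * pq.2)) +
          αd * Real.log (1 + Gd * pq.2 / (s + GI * pq.1)) := by
  have hcont : ContinuousOn (fun x : ℝ × ℝ =>
      αu * Real.log (1 + Gu * x.1 / (s + β * x.2)) +
        αd * Real.log (1 + Gd * x.2 / (s + GI * x.1)))
      (Set.Icc (0 : ℝ) Pmax ×ˢ Set.Icc (0 : ℝ) Pmax) := by
    intro x hx
    obtain ⟨⟨h1, -⟩, ⟨h2, -⟩⟩ := hx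
    apply ContinuousAt.continuousWithinAt
    have e1 : s + β * x.2 ≠ 0 := by positivity
    have e2 : s + GI * x.1 ≠ 0 := by positivity
    have e3 : 1 + Gu * x.1 / (s + β * x.2) ≠ 0 := by positivity
    have e4 : 1 + Gd * x.2 / (s + GI * x.1) ≠ 0 := by positivity
    fun_prop (disch := assumption)
  obtain ⟨⟨p, q⟩, ⟨⟨hp, hpP⟩, ⟨hq, hqP⟩⟩, hmax⟩ :=
    (isCompact_Icc.prod isCompact_Icc).exists_isMaxOn
      ⟨((0 : ℝ), (0 : ℝ)), ⟨⟨le_refl _, hP.le⟩, ⟨le_refl _, hP.le⟩⟩⟩ hcont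
  simp only at hp hpP hq hqP
  have hex : ∃ p' q' : ℝ, 0 ≤ p' ∧ p' ≤ Pmax ∧ 0 ≤ q' ∧ q' ≤ Pmax ∧
      (p' = Pmax ∨ q' = Pmax) ∧
      Gu * p / (s + β * q) ≤ Gu * p' / (s + β * q') ∧
      Gd * q / (s + GI * p) ≤ Gd * q' / (s + GI * p') := by
    by_cases h : 0 < p ∨ 0 < q
    · obtain ⟨t, ht, h1, h2, h3⟩ := scale_exists hp hq hpP hqP h
      have ht0 : 0 ≤ t := by linarith
      exact ⟨t * p, t * q, by positivity, h1, by positivity, h2, h3,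
        sinr_scale hGu hβ hs hp hq ht, sinr_scale hGd hGI hs hq hp ht⟩
    · have hp0 : p = 0 := by
        by_contra hne
        exact h (Or.inl (lt_of_le_of_ne hp (Ne.symm hne)))
      have hq0 : q = 0 := by
        by_contra hne
        exact h (Or.inr (lt_of_le_of_ne hq (Ne.symm hne)))
      subst hp0 hq0
      refine ⟨Pmax, 0, hP.le, le_refl _, le_refl _, hP.le, Or.inl rfl, ?_, ?_⟩
      · simp only [mul_zero, zero_div, add_zero]
        positivity
      · simp
  obtain ⟨p', q', hp', hpP', hq', hqP', hor, hu, hd⟩ := hex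
  refine ⟨(p', q'), ⟨⟨hp', hpP'⟩, ⟨hq', hqP'⟩⟩, hor, ?_⟩
  intro a b ha hb
  have h1 := hmax (show (a, b) ∈ Set.Icc (0 : ℝ) Pmax ×ˢ Set.Icc (0 : ℝ) Pmax from ⟨ha, hb⟩)
  simp only [Set.mem_setOf_eq] at h1
  refine h1.trans ?_
  have l1 : Real.log (1 + Gu * p / (s + β * q)) ≤ Real.log (1 + Gu * p' / (s + β * q')) :=
    Real.log_le_log (by positivity) (by linarith)
  have l2 : Real.log (1 + Gd * q / (s + GI * p)) ≤ Real.log (1 + Gd * q' / (s + GI * p')) :=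
    Real.log_le_log (by positivity) (by linarith)
  exact add_le_add (mul_le_mul_of_nonneg_left l1 hαu.le) (mul_le_mul_of_nonneg_left l2 hαd.le)
end
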